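/- Let G be a group, T ≤ G a subgroup, and Z a subgroup of the center of G with Z ≤ T. Let Z^Δ = {(z,z) : z ∈ Z} ≤ T × G, let Q = (T × G)/Z^Δ, and let pr₁ : Q → T/Z be the homomorphism induced by (t,g) ↦ tZ. Since Z is central in G, conjugation induces a well-defined homomorphism c : T/Z → Aut(G) with c(tZ)(g) = t g t⁻¹. Let A be a group, λ : A → T/Z a group homomorphism, φ = c∘λ : A → Aut(G), and let ι : T/Z → Q be the homomorphism induced by t ↦ (t,t). Then the map G ⋊[φ] A → A × Q, (g,a) ↦ (a, [(1,g)]·ι(λ(a))), is an injective group homomorphism whose image is the fiber-product subgroup {(a,q) ∈ A × Q : pr₁(q) = λ(a)}. -/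

import Mathlib

/-- A central subgroup `Z ≤ T` gives a normal subgroup `Z.subgroupOf T` of `T`. -/
theorem central_subgroupOf_normal {G : Type*} [Group G] (T Z : Subgroup G)
    (hZc : Z ≤ Subgroup.center G) : (Z.subgroupOf T).Normal := by
  constructor
  intro n hn t
  have h : (t * n * t⁻¹ : T) = n := by
    refine Subtype.ext ?_
    show (t : G) * (n : G) * (t : G)⁻¹ = (n : G)
    rw [mul_inv_eq_iff_eq_mul]
    exact Subgroup.mem_center_iff.mp (hZc hn) (t : G)
  rwa [h]

/-- The diagonal copy `Z^Δ = {(z, z) : z ∈ Z}` of a central subgroup `Z ≤ T`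
inside `T × G` is a normal subgroup. -/
theorem diag_range_normal {G : Type*} [Group G] (T Z : Subgroup G)
    (hZc : Z ≤ Subgroup.center G) (hZT : Z ≤ T) :
    ((Subgroup.inclusion hZT).prod Z.subtype).range.Normal := by
  constructor
  rintro _ ⟨z, rfl⟩ ⟨t, g⟩
  refine ⟨z, ?_⟩
  have h1 : t * Subgroup.inclusion hZT z * t⁻¹ = Subgroup.inclusion hZT z := by
    refine Subtype.ext ?_
    show (t : G) * (z : G) * (t : G)⁻¹ = (z : G)
    rw [mul_inv_eq_iff_eq_mul]
    exact Subgroup.mem_center_iff.mp (hZc z.2) (t : G)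
  have h2 : g * (z : G) * g⁻¹ = (z : G) := by
    rw [mul_inv_eq_iff_eq_mul]
    exact Subgroup.mem_center_iff.mp (hZc z.2) g
  exact Prod.ext h1.symm h2.symm

/-- Conjugation `c : T/Z →* Aut G`, `c(tZ)(g) = t g t⁻¹`, well defined since `Z` is
central in `G`. -/
def conjQuot {G : Type*} [Group G] (T Z : Subgroup G)
    (hZc : Z ≤ Subgroup.center G) :
    haveI : (Z.subgroupOf T).Normal := central_subgroupOf_normal T Z hZc
    (T ⧸ Z.subgroupOf T) →* MulAut G :=
  haveI : (Z.subgroupOf T).Normal := central_subgroupOf_normal T Z hZc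
  QuotientGroup.lift (Z.subgroupOf T) (MulAut.conj.comp T.subtype)
    (by
      intro z hz
      ext g
      show (z : G) * g * (z : G)⁻¹ = g
      rw [mul_inv_eq_iff_eq_mul]
      exact (Subgroup.mem_center_iff.mp (hZc (Subgroup.mem_subgroupOf.mp hz)) g).symm)

/-- The projection `pr₁ : (T × G)/Z^Δ →* T/Z` induced by `(t, g) ↦ tZ`. -/
def prOne {G : Type*} [Group G] (T Z : Subgroup G)
    (hZc : Z ≤ Subgroup.center G) (hZT : Z ≤ T) :
    haveI : (Z.subgroupOf T).Normal := central_subgroupOf_normal T Z hZc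
    haveI : ((Subgroup.inclusion hZT).prod Z.subtype).range.Normal :=
      diag_range_normal T Z hZc hZT
    ((T × G) ⧸ ((Subgroup.inclusion hZT).prod Z.subtype).range) →* T ⧸ Z.subgroupOf T :=
  haveI : (Z.subgroupOf T).Normal := central_subgroupOf_normal T Z hZc
  haveI : ((Subgroup.inclusion hZT).prod Z.subtype).range.Normal :=
    diag_range_normal T Z hZc hZT
  QuotientGroup.lift _ ((QuotientGroup.mk' (Z.subgroupOf T)).comp (MonoidHom.fst T G))
    (by
      rintro _ ⟨z, rfl⟩
      have h : Subgroup.inclusion hZT z ∈ Z.subgroupOf T := by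
        simp [Subgroup.mem_subgroupOf, z.2]
      simpa [QuotientGroup.eq_one_iff] using h)

/-- The homomorphism `ι : T/Z →* (T × G)/Z^Δ` induced by `t ↦ (t, t)`. -/
def iotaQ {G : Type*} [Group G] (T Z : Subgroup G)
    (hZc : Z ≤ Subgroup.center G) (hZT : Z ≤ T) :
    haveI : (Z.subgroupOf T).Normal := central_subgroupOf_normal T Z hZc
    haveI : ((Subgroup.inclusion hZT).prod Z.subtype).range.Normal :=
      diag_range_normal T Z hZc hZT
    (T ⧸ Z.subgroupOf T) →*
      ((T × G) ⧸ ((Subgroup.inclusion hZT).prod Z.subtype).range) :=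
  haveI : (Z.subgroupOf T).Normal := central_subgroupOf_normal T Z hZc
  haveI : ((Subgroup.inclusion hZT).prod Z.subtype).range.Normal :=
    diag_range_normal T Z hZc hZT
  QuotientGroup.lift _
    ((QuotientGroup.mk' _).comp ((MonoidHom.id T).prod T.subtype))
    (by
      intro z hz
      have h : ((MonoidHom.id T).prod T.subtype) z
          ∈ ((Subgroup.inclusion hZT).prod Z.subtype).range :=
        ⟨⟨(z : G), Subgroup.mem_subgroupOf.mp hz⟩, Prod.ext (Subtype.ext rfl) rfl⟩
      simpa [QuotientGroup.eq_one_iff] using h)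

/-- Conjugation by `ι q` on the second factor of `(T × G)/Z^Δ` is the action of `q` on `G`. -/
theorem iotaQ_mul_mk {G : Type*} [Group G] (T Z : Subgroup G)
    (hZc : Z ≤ Subgroup.center G) (hZT : Z ≤ T) :
    haveI : (Z.subgroupOf T).Normal := central_subgroupOf_normal T Z hZc
    haveI : ((Subgroup.inclusion hZT).prod Z.subtype).range.Normal :=
      diag_range_normal T Z hZc hZT
    ∀ (q : T ⧸ Z.subgroupOf T) (g : G),
      iotaQ T Z hZc hZT q * QuotientGroup.mk ((1 : T), g) =
        QuotientGroup.mk ((1 : T), conjQuot T Z hZc q g) * iotaQ T Z hZc hZT q := by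
  intro q g
  induction q using QuotientGroup.induction_on with
  | H t =>
    refine congrArg (QuotientGroup.mk (s := ((Subgroup.inclusion hZT).prod Z.subtype).range))
      (a₁ := (t, (t : G)) * (1, g)) (a₂ := (1, (t : G) * g * (t : G)⁻¹) * (t, (t : G))) ?_
    simp

/-- The second factor `G` embeds in `(T × G)/Z^Δ`. -/
theorem mk_one_injective {G : Type*} [Group G] (T Z : Subgroup G) (hZT : Z ≤ T) :
    Function.Injective fun g : G =>
      (QuotientGroup.mk ((1 : T), g) :
        (T × G) ⧸ ((Subgroup.inclusion hZT).prod Z.subtype).range) := by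
  intro g h hgh
  obtain ⟨z, hz⟩ := QuotientGroup.eq.mp hgh
  obtain ⟨h1, h2⟩ := Prod.ext_iff.mp hz
  have hz1 : (z : G) = 1 := by simpa using congrArg (Subtype.val : T → G) h1
  have h3 : (z : G) = g⁻¹ * h := h2
  exact inv_mul_eq_one.mp (h3.symm.trans hz1)

/-- `pr₁` is trivial on the second factor and `ι` is a section of it. -/
theorem prOne_mk_mul_iotaQ {G : Type*} [Group G] (T Z : Subgroup G)
    (hZc : Z ≤ Subgroup.center G) (hZT : Z ≤ T) :
    haveI : (Z.subgroupOf T).Normal := central_subgroupOf_normal T Z hZc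
    haveI : ((Subgroup.inclusion hZT).prod Z.subtype).range.Normal :=
      diag_range_normal T Z hZc hZT
    ∀ (g : G) (q : T ⧸ Z.subgroupOf T),
      prOne T Z hZc hZT (QuotientGroup.mk ((1 : T), g) * iotaQ T Z hZc hZT q) = q := by
  intro g q
  induction q using QuotientGroup.induction_on with
  | H t => exact congrArg (QuotientGroup.mk (s := Z.subgroupOf T)) (one_mul t)

/-- Every `q` in `(T × G)/Z^Δ` decomposes as `[(1, g)]·ι(pr₁ q)`. -/
theorem exists_mk_mul_iotaQ_prOne {G : Type*} [Group G] (T Z : Subgroup G)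
    (hZc : Z ≤ Subgroup.center G) (hZT : Z ≤ T) :
    haveI : (Z.subgroupOf T).Normal := central_subgroupOf_normal T Z hZc
    haveI : ((Subgroup.inclusion hZT).prod Z.subtype).range.Normal :=
      diag_range_normal T Z hZc hZT
    ∀ q : (T × G) ⧸ ((Subgroup.inclusion hZT).prod Z.subtype).range,
      ∃ g : G, QuotientGroup.mk ((1 : T), g) * iotaQ T Z hZc hZT (prOne T Z hZc hZT q) = q := by
  intro q
  induction q using QuotientGroup.induction_on with
  | H x =>
    obtain ⟨t, g⟩ := x
    refine ⟨g * (t : G)⁻¹, ?_⟩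
    refine congrArg (QuotientGroup.mk (s := ((Subgroup.inclusion hZT).prod Z.subtype).range))
      (a₁ := (1, g * (t : G)⁻¹) * (t, (t : G))) (a₂ := (t, g)) ?_
    simp

/-- Lemma 3.1: the fiber product of `(T × G)/Z^Δ` and `A` over `T/Z` along a
homomorphism `λ : A →* T/Z` may be written as the semidirect product `G ⋊ A`, where
`A` acts on `G` by conjugation through `λ`: the map `(g, a) ↦ (a, [(1, g)]·ι(λ a))`
is an injective homomorphism onto the fiber-product subgroup. -/
theorem semidirect_iso_fiberProduct {G : Type*} [Group G] (T Z : Subgroup G)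
    {A : Type*} [Group A]
    (hZc : Z ≤ Subgroup.center G) (hZT : Z ≤ T) :
    haveI : (Z.subgroupOf T).Normal := central_subgroupOf_normal T Z hZc
    haveI : ((Subgroup.inclusion hZT).prod Z.subtype).range.Normal :=
      diag_range_normal T Z hZc hZT
    ∀ lcoc : A →* T ⧸ Z.subgroupOf T,
    ∃ Ψ : (G ⋊[(conjQuot T Z hZc).comp lcoc] A) →*
        A × ((T × G) ⧸ ((Subgroup.inclusion hZT).prod Z.subtype).range),
      (∀ x : G ⋊[(conjQuot T Z hZc).comp lcoc] A,
        Ψ x = (x.right,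
          QuotientGroup.mk ((1 : T), x.left) * iotaQ T Z hZc hZT (lcoc x.right))) ∧
      Function.Injective Ψ ∧
      (∀ p : A × ((T × G) ⧸ ((Subgroup.inclusion hZT).prod Z.subtype).range),
        p ∈ Ψ.range ↔ prOne T Z hZc hZT p.2 = lcoc p.1) := by
  have : (Z.subgroupOf T).Normal := central_subgroupOf_normal T Z hZc
  have : ((Subgroup.inclusion hZT).prod Z.subtype).range.Normal :=
    diag_range_normal T Z hZc hZT
  intro lcoc
  refine ⟨MonoidHom.mk' (fun x : G ⋊[(conjQuot T Z hZc).comp lcoc] A => (x.right,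
    QuotientGroup.mk ((1 : T), x.left) * iotaQ T Z hZc hZT (lcoc x.right))) ?_,
    fun _ => rfl, ?_, ?_⟩
  · intro x y
    refine Prod.ext rfl ?_
    have hmk : ∀ g h : G,
        (QuotientGroup.mk ((1 : T), g * h) :
          (T × G) ⧸ ((Subgroup.inclusion hZT).prod Z.subtype).range) =
        QuotientGroup.mk ((1 : T), g) * QuotientGroup.mk ((1 : T), h) := fun g h =>
      congrArg (QuotientGroup.mk (s := ((Subgroup.inclusion hZT).prod Z.subtype).range))
        (a₁ := (1, g * h)) (a₂ := (1, g) * (1, h)) (by simp)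
    simp only [SemidirectProduct.mul_left, SemidirectProduct.mul_right, Prod.snd_mul, map_mul,
      hmk, MonoidHom.comp_apply, mul_assoc]
    rw [← mul_assoc (iotaQ T Z hZc hZT (lcoc x.right)), iotaQ_mul_mk T Z hZc hZT, mul_assoc]
  · intro x y hxy
    obtain ⟨hr, hl⟩ := Prod.ext_iff.mp hxy
    have hr : x.right = y.right := hr
    simp only [MonoidHom.mk'_apply, hr] at hl
    exact SemidirectProduct.ext (mk_one_injective T Z hZT (mul_right_cancel hl)) hr
  · rintro ⟨a, q⟩
    constructor
    · rintro ⟨x, hx⟩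
      obtain ⟨rfl, rfl⟩ := Prod.ext_iff.mp hx
      exact prOne_mk_mul_iotaQ T Z hZc hZT x.left (lcoc x.right)
    · intro h
      obtain ⟨g, hg⟩ := exists_mk_mul_iotaQ_prOne T Z hZc hZT q
      refine ⟨⟨g, a⟩, Prod.ext rfl ?_⟩
      have h : prOne T Z hZc hZT q = lcoc a := h
      rw [h] at hg
      exact hg
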